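/- arXiv:1703.04867 — 2 statements merged into one kernel-verified Lean document; each statement's English description precedes it below -/
import Mathlib

section
/- The number of toroidal knot (2,2)-mosaics is D_T^{(2,2)} = 110. -/
/-- Connection point on the left edge, for each of the eleven mosaic tiles `T_0, …, T_10`. -/
def cpL : Fin 11 → Bool := ![false, true, false, false, true, true, false, true, true, true, true]
/-- Connection point on the right edge. -/
def cpR : Fin 11 → Bool := ![false, false, true, true, false, true, false, true, true, true, true]
/-- Connection point on the top edge. -/
def cpT : Fin 11 → Bool := ![false, false, false, true, true, false, true, true, true, true, true]
/-- Connection point on the bottom edge. -/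
def cpB : Fin 11 → Bool := ![false, true, true, false, false, false, true, true, true, true, true]

/-- An `(m,n)`-mosaic: an `m × n` matrix of mosaic tiles (row `i`, column `j`). -/
abbrev Mosaic (m n : ℕ) := Fin m → Fin n → Fin 11

/-- Suitably connected: contiguous tiles agree about connection points on their common edge. -/
def SuitablyConnected {m n : ℕ} (M : Mosaic m n) : Prop :=
  (∀ (i : Fin m) (j : Fin n) (h : j.val + 1 < n),
      cpR (M i j) = cpL (M i ⟨j.val + 1, h⟩)) ∧
  (∀ (i : Fin m) (h : i.val + 1 < m) (j : Fin n),
      cpB (M i j) = cpT (M ⟨i.val + 1, h⟩ j))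

/-- Suitably ∂-connected: tiles on opposite ends of a row (resp. column) agree about
connection points on the outer boundary edges. -/
def SuitablyBdryConnected {m n : ℕ} (M : Mosaic m n) : Prop :=
  (∀ (i : Fin m) (j j' : Fin n), j.val = 0 → j'.val = n - 1 →
      cpL (M i j) = cpR (M i j')) ∧
  (∀ (i i' : Fin m) (j : Fin n), i.val = 0 → i'.val = m - 1 →
      cpT (M i j) = cpB (M i' j))

/-- A period knot `(m,n)`-mosaic. -/
def PeriodKnot {m n : ℕ} (M : Mosaic m n) : Prop :=
  SuitablyConnected M ∧ SuitablyBdryConnected M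

/-- `D_P^{(m,n)}`, the number of period knot `(m,n)`-mosaics. -/
noncomputable def DP (m n : ℕ) : ℕ := Nat.card {M : Mosaic m n // PeriodKnot M}

/-- No connection points on the boundary of the mosaic. -/
def BoundaryFree {m n : ℕ} (M : Mosaic m n) : Prop :=
  ∀ (i : Fin m) (j : Fin n),
    (j.val = 0 → cpL (M i j) = false) ∧ (j.val = n - 1 → cpR (M i j) = false) ∧
    (i.val = 0 → cpT (M i j) = false) ∧ (i.val = m - 1 → cpB (M i j) = false)

/-- `D^{(m,n)}`, the number of knot `(m,n)`-mosaics. -/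
noncomputable def DK (m n : ℕ) : ℕ :=
  Nat.card {M : Mosaic m n // SuitablyConnected M ∧ BoundaryFree M}

/-- Subtract `x` from the index `i`, modulo `m`. -/
def shiftIdx {m : ℕ} (x : ℤ) (i : Fin m) : Fin m :=
  ⟨(((i : ℤ) - x) % (m : ℤ)).toNat, by
    have hm : (0 : ℤ) < (m : ℤ) := by exact_mod_cast i.pos
    have h1 := Int.emod_lt_of_pos ((i : ℤ) - x) hm
    have h2 := Int.emod_nonneg ((i : ℤ) - x) (by omega : (m : ℤ) ≠ 0)
    omega⟩

/-- The cyclic rotation `t_{x,y}`: `(t_{x,y} M)_{i,j} = M_{i-x, j-y}` (indices mod `m`, `n`). -/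
def tshift {m n : ℕ} (x y : ℤ) (M : Mosaic m n) : Mosaic m n :=
  fun i j => M (shiftIdx x i) (shiftIdx y j)

/-- `M` is a `(p,q)`-f.period mosaic: `p` is the least positive integer with `M = t_{p,0}(M)`
and `q` is the least positive integer with `M = t_{0,q}(M)`. -/
def IsFPeriod {m n : ℕ} (p q : ℕ) (M : Mosaic m n) : Prop :=
  IsLeast {a : ℕ | 0 < a ∧ M = tshift (a : ℤ) 0 M} p ∧
  IsLeast {b : ℕ | 0 < b ∧ M = tshift 0 (b : ℤ) M} q

/-- `d_{p,q}`: the number of `(p,q)`-f.period knot `(m,n)`-mosaics. -/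
noncomputable def dFP (m n p q : ℕ) : ℕ :=
  Nat.card {M : Mosaic m n // PeriodKnot M ∧ IsFPeriod p q M}

/-- Equivalence of period knot mosaics under cyclic rotations of rows and columns. -/
def torRel (m n : ℕ) (A B : {M : Mosaic m n // PeriodKnot M}) : Prop :=
  ∃ x y : ℤ, tshift x y A.val = B.val

/-- `D_T^{(m,n)}`, the number of toroidal knot `(m,n)`-mosaics. -/
noncomputable def DT (m n : ℕ) : ℕ := Nat.card (Quot (torRel m n))

/-- `M` is a `p_{(k,1)}`-f.period knot `(p,p)`-mosaic: not `(1,1)`-f.period and `M = t_{k,1}(M)`. -/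
def IsPk1FPeriod {p : ℕ} (k : ℕ) (M : Mosaic p p) : Prop :=
  ¬ IsFPeriod 1 1 M ∧ M = tshift (k : ℤ) 1 M

/-- `d_{p_{(k,1)}}`: the number of `p_{(k,1)}`-f.period knot `(p,p)`-mosaics. -/
noncomputable def dPk (p k : ℕ) : ℕ :=
  Nat.card {M : Mosaic p p // PeriodKnot M ∧ IsPk1FPeriod k M}

/-- `d_{p²}`: the number of period knot `(p,p)`-mosaics that are not `(1,1)`-, not `(1,p)`-
and not `p_{(k,1)}`-f.period for any `k`. -/
noncomputable def dPsq (p : ℕ) : ℕ :=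
  Nat.card {M : Mosaic p p // PeriodKnot M ∧ ¬ IsFPeriod 1 1 M ∧ ¬ IsFPeriod 1 p M ∧
    ∀ k < p, ¬ IsPk1FPeriod k M}

/-- Entries of the pair `(X_k, O_k)` of `2^k × 2^k` matrices defined by the block recursion
`X_{k+1} = [[X_k, O_k], [O_k, X_k]]`, `O_{k+1} = [[O_k, X_k], [X_k, 4 O_k]]`,
seeded with `X_0 = O_0 = [1]` (the most significant bit selects the block). -/
def matsXO : ℕ → ℕ → ℕ → ℕ × ℕ
  | 0, _, _ => (1, 1)
  | k + 1, i, j =>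
    let v := matsXO k (i % 2 ^ k) (j % 2 ^ k)
    if i / 2 ^ k % 2 = 0 then
      if j / 2 ^ k % 2 = 0 then (v.1, v.2) else (v.2, v.1)
    else
      if j / 2 ^ k % 2 = 0 then (v.2, v.1) else (v.1, 4 * v.2)

/-- The matrix `X_k`. -/
def Xmat (m : ℕ) : Matrix (Fin (2 ^ m)) (Fin (2 ^ m)) ℕ :=
  Matrix.of fun i j => (matsXO m i j).1

/-- The matrix `O_k`. -/
def Omat (m : ℕ) : Matrix (Fin (2 ^ m)) (Fin (2 ^ m)) ℕ :=
  Matrix.of fun i j => (matsXO m i j).2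

/-- Entries of the quadruple `(X_k^+, X_k^-, O_k^+, O_k^-)` of `2^k × 2^k` matrices defined by
the block recursions `X_{k+1}^+ = [[X_k^+, O_k^-],[O_k^-, X_k^+]]`,
`X_{k+1}^- = [[X_k^-, O_k^+],[O_k^+, X_k^-]]`, `O_{k+1}^+ = [[O_k^+, X_k^-],[X_k^-, 4 O_k^+]]`,
`O_{k+1}^- = [[O_k^-, X_k^+],[X_k^+, 4 O_k^-]]`, seeded with `X_0^+ = O_0^+ = [1]`,
`X_0^- = O_0^- = [0]` (the most significant bit selects the block). -/
def matsPM : ℕ → ℕ → ℕ → ℕ × ℕ × ℕ × ℕ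
  | 0, _, _ => (1, 0, 1, 0)
  | k + 1, i, j =>
    let v := matsPM k (i % 2 ^ k) (j % 2 ^ k)
    match v with
    | (xp, xm, op, om) =>
      if i / 2 ^ k % 2 = 0 then
        if j / 2 ^ k % 2 = 0 then (xp, xm, op, om) else (om, op, xm, xp)
      else
        if j / 2 ^ k % 2 = 0 then (om, op, xm, xp) else (xp, xm, 4 * op, 4 * om)

/-- The matrix `X_m^+`. -/
def Xplus (m : ℕ) : Matrix (Fin (2 ^ m)) (Fin (2 ^ m)) ℕ :=
  Matrix.of fun i j => (matsPM m i j).1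
/-- The matrix `X_m^-`. -/
def Xminus (m : ℕ) : Matrix (Fin (2 ^ m)) (Fin (2 ^ m)) ℕ :=
  Matrix.of fun i j => (matsPM m i j).2.1
/-- The matrix `O_m^+`. -/
def Oplus (m : ℕ) : Matrix (Fin (2 ^ m)) (Fin (2 ^ m)) ℕ :=
  Matrix.of fun i j => (matsPM m i j).2.2.1
/-- The matrix `O_m^-`. -/
def Ominus (m : ℕ) : Matrix (Fin (2 ^ m)) (Fin (2 ^ m)) ℕ :=
  Matrix.of fun i j => (matsPM m i j).2.2.2

/-- The boundary state (a word in `{o,x}^m`) encoded by `a : Fin (2^m)` in reverse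
lexicographic order: the first position is the least significant bit. -/
def stateOf {m : ℕ} (a : Fin (2 ^ m)) : Fin m → Bool := fun r => (a : ℕ).testBit r.val

/-- The `l`-state of a mosaic. -/
def lState {m n : ℕ} (hn : 0 < n) (M : Mosaic m n) : Fin m → Bool :=
  fun i => cpL (M i ⟨0, hn⟩)
/-- The `r`-state of a mosaic. -/
def rState {m n : ℕ} (hn : 0 < n) (M : Mosaic m n) : Fin m → Bool :=
  fun i => cpR (M i ⟨n - 1, Nat.sub_lt hn Nat.one_pos⟩)
/-- The `t`-state of a mosaic. -/
def tState {m n : ℕ} (hm : 0 < m) (M : Mosaic m n) : Fin n → Bool :=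
  fun j => cpT (M ⟨0, hm⟩ j)
/-- The `b`-state of a mosaic. -/
def bState {m n : ℕ} (hm : 0 < m) (M : Mosaic m n) : Fin n → Bool :=
  fun j => cpB (M ⟨m - 1, Nat.sub_lt hm Nat.one_pos⟩ j)

/-- The state matrix `N^{(m,n)+}`: its `(a,b)` entry counts the suitably connected
`(m,n)`-mosaics whose `t`-state equals its `b`-state, whose `l`-state is the `a`-th state
and whose `r`-state is the `b`-th state. -/
noncomputable def Nplus (m n : ℕ) (hm : 0 < m) (hn : 0 < n) :
    Matrix (Fin (2 ^ m)) (Fin (2 ^ m)) ℕ :=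
  Matrix.of fun a b => Nat.card {M : Mosaic m n // SuitablyConnected M ∧
    tState hm M = bState hm M ∧ lState hn M = stateOf a ∧ rState hn M = stateOf b}

/-- The index map `α` for `tr^{(k)}`: cyclic shift by `k` positions of the `p`-bit binary
representation, i.e. `α(i) ≡ 2^k i (mod 2^p - 1)` for `0 < i < 2^p - 1`, `α(0) = 0`,
`α(2^p-1) = 2^p-1`. -/
def alphaIdx (p k : ℕ) (i : Fin (2 ^ p)) : Fin (2 ^ p) :=
  if h : (i : ℕ) = 2 ^ p - 1 then i
  else ⟨(2 ^ k * (i : ℕ)) % (2 ^ p - 1), by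
    have h1 : 0 < 2 ^ p := Nat.two_pow_pos p
    have h2 : (i : ℕ) < 2 ^ p := i.isLt
    have h3 : 0 < 2 ^ p - 1 := by omega
    have h4 := Nat.mod_lt (2 ^ k * (i : ℕ)) h3
    omega⟩

/-- The twisted trace `tr^{(k)}(A) = Σ_i A_{i+1, α(i)+1}`. -/
def trk (p k : ℕ) (A : Matrix (Fin (2 ^ p)) (Fin (2 ^ p)) ℕ) : ℕ :=
  ∑ i, A i (alphaIdx p k i)

/-- Numerical code of a `2 × 2` block. -/
def key4 (a b c d : Fin 11) : ℕ := 1331 * a.val + 121 * b.val + 11 * c.val + d.val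

theorem key4_inj {a b c d a' b' c' d' : Fin 11} (h : key4 a b c d = key4 a' b' c' d') :
    a = a' ∧ b = b' ∧ c = c' ∧ d = d' := by
  unfold key4 at h
  refine ⟨?_, ?_, ?_, ?_⟩ <;> apply Fin.ext <;> omega

/-- Least code among the four rotations. -/
def minKey (a b c d : Fin 11) : ℕ :=
  min (min (key4 a b c d) (key4 b a d c)) (min (key4 c d a b) (key4 d c b a))

/-- Being a period knot mosaic, in terms of the four entries. -/
def good4 (a b c d : Fin 11) : Bool :=
  (cpR a == cpL b) && (cpR b == cpL a) && (cpR c == cpL d) && (cpR d == cpL c) &&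
  (cpB a == cpT c) && (cpB c == cpT a) && (cpB b == cpT d) && (cpB d == cpT b)

theorem good_iff (M : Mosaic 2 2) :
    PeriodKnot M ↔ good4 (M 0 0) (M 0 1) (M 1 0) (M 1 1) = true := by
  simp only [good4, Bool.and_eq_true, beq_iff_eq]
  constructor
  · rintro ⟨⟨h1, h2⟩, h3, h4⟩
    exact ⟨⟨⟨⟨⟨⟨⟨h1 0 0 (by decide), (h3 0 0 1 rfl rfl).symm⟩, h1 1 0 (by decide)⟩,
      (h3 1 0 1 rfl rfl).symm⟩, h2 0 (by decide) 0⟩, (h4 0 1 0 rfl rfl).symm⟩,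
      h2 0 (by decide) 1⟩, (h4 0 1 1 rfl rfl).symm⟩
  · rintro ⟨⟨⟨⟨⟨⟨⟨h1, h2⟩, h3⟩, h4⟩, h5⟩, h6⟩, h7⟩, h8⟩
    refine ⟨⟨?_, ?_⟩, ?_, ?_⟩
    · intro i j h
      obtain rfl : j = 0 := by apply Fin.ext; simp; omega
      fin_cases i
      · exact h1
      · exact h3
    · intro i h j
      obtain rfl : i = 0 := by apply Fin.ext; simp; omega
      fin_cases j
      · exact h5
      · exact h7
    · intro i j j' hj hj'
      obtain rfl : j = 0 := Fin.ext hj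
      obtain rfl : j' = 1 := Fin.ext hj'
      fin_cases i
      · exact h2.symm
      · exact h4.symm
    · intro i i' j hj hj'
      obtain rfl : i = 0 := Fin.ext hj
      obtain rfl : i' = 1 := Fin.ext hj'
      fin_cases j
      · exact h6.symm
      · exact h8.symm

theorem shift_cases (x : ℤ) :
    ((shiftIdx x (0 : Fin 2) = 0 ∧ shiftIdx x (1 : Fin 2) = 1) ∨
     (shiftIdx x (0 : Fin 2) = 1 ∧ shiftIdx x (1 : Fin 2) = 0)) := by
  rcases Int.emod_two_eq_zero_or_one x with h | h
  · left
    constructor <;> apply Fin.ext <;> simp [shiftIdx] <;> omega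
  · right
    constructor <;> apply Fin.ext <;> simp [shiftIdx] <;> omega

/-- Least code of a mosaic. -/
def mKey (M : Mosaic 2 2) : ℕ := minKey (M 0 0) (M 0 1) (M 1 0) (M 1 1)

theorem mKey_tshift (x y : ℤ) (M : Mosaic 2 2) : mKey (tshift x y M) = mKey M := by
  unfold mKey minKey tshift
  rcases shift_cases x with ⟨h1, h2⟩ | ⟨h1, h2⟩ <;> rcases shift_cases y with ⟨h3, h4⟩ | ⟨h3, h4⟩ <;>
    rw [h1, h2, h3, h4] <;> omega

/-- The mosaic with given entries. -/
def mk4 (t : Fin 11 × Fin 11 × Fin 11 × Fin 11) : Mosaic 2 2 := ![![t.1, t.2.1], ![t.2.2.1, t.2.2.2]]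

/-- Canonical representatives. -/
def ok4 (a b c d : Fin 11) : Bool := good4 a b c d && Nat.ble (key4 a b c d) (minKey a b c d)

theorem count_ok : (∑ a : Fin 11, ∑ b : Fin 11, ∑ c : Fin 11, ∑ d : Fin 11,
    if ok4 a b c d = true then 1 else 0) = 110 := by
  decide +kernel

theorem good_mk4 {t : Fin 11 × Fin 11 × Fin 11 × Fin 11}
    (h : ok4 t.1 t.2.1 t.2.2.1 t.2.2.2 = true) : PeriodKnot (mk4 t) := by
  rw [good_iff]
  simp only [ok4, Bool.and_eq_true] at h
  exact h.1

/-- The class of a canonical representative. -/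
def toQuot (t : {t : Fin 11 × Fin 11 × Fin 11 × Fin 11 // ok4 t.1 t.2.1 t.2.2.1 t.2.2.2 = true}) :
    Quot (torRel 2 2) := Quot.mk _ ⟨mk4 t.1, good_mk4 t.2⟩

/-- The least code of a class. -/
def qKey : Quot (torRel 2 2) → ℕ :=
  Quot.lift (fun A => mKey A.1) (by
    rintro A B ⟨x, y, h⟩
    show mKey A.1 = mKey B.1
    rw [← h, mKey_tshift])

theorem ok_key {a b c d : Fin 11} (h : ok4 a b c d = true) : minKey a b c d = key4 a b c d := by
  simp only [ok4, Bool.and_eq_true, Nat.ble_eq] at h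
  have := h.2
  unfold minKey at *
  omega

theorem toQuot_inj : Function.Injective toQuot := by
  rintro ⟨⟨a, b, c, d⟩, h⟩ ⟨⟨a', b', c', d'⟩, h'⟩ e
  have e2 : minKey a b c d = minKey a' b' c' d' := congrArg qKey e
  rw [ok_key h, ok_key h'] at e2
  obtain ⟨rfl, rfl, rfl, rfl⟩ := key4_inj e2
  rfl

theorem exists_shift (M : Mosaic 2 2) : ∃ x y : ℤ,
    key4 (tshift x y M 0 0) (tshift x y M 0 1) (tshift x y M 1 0) (tshift x y M 1 1) = mKey M := by
  have h : mKey M = key4 (M 0 0) (M 0 1) (M 1 0) (M 1 1) ∨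
      mKey M = key4 (M 0 1) (M 0 0) (M 1 1) (M 1 0) ∨
      mKey M = key4 (M 1 0) (M 1 1) (M 0 0) (M 0 1) ∨
      mKey M = key4 (M 1 1) (M 1 0) (M 0 1) (M 0 0) := by
    unfold mKey minKey
    omega
  rcases h with h | h | h | h
  · exact ⟨0, 0, h.symm⟩
  · exact ⟨0, 1, h.symm⟩
  · exact ⟨1, 0, h.symm⟩
  · exact ⟨1, 1, h.symm⟩

theorem good_tshift (x y : ℤ) (M : Mosaic 2 2) (h : PeriodKnot M) : PeriodKnot (tshift x y M) := by
  rw [good_iff] at *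
  simp only [good4, Bool.and_eq_true, beq_iff_eq, tshift] at *
  rcases shift_cases x with ⟨h1, h2⟩ | ⟨h1, h2⟩ <;> rcases shift_cases y with ⟨h3, h4⟩ | ⟨h3, h4⟩ <;>
    rw [h1, h2, h3, h4] <;> tauto

theorem toQuot_surj : Function.Surjective toQuot := by
  intro q
  induction q using Quot.ind with
  | mk A =>
    obtain ⟨x, y, h⟩ := exists_shift A.1
    have hg := good_tshift x y A.1 A.2
    have hk := mKey_tshift x y A.1
    set N := tshift x y A.1 with hN
    have hg2 := (good_iff N).1 hg
    refine ⟨⟨(N 0 0, N 0 1, N 1 0, N 1 1), ?_⟩, ?_⟩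
    · simp only [ok4, hg2, Bool.true_and, Nat.ble_eq]
      rw [h, ← hk]
      exact le_refl _
    · symm
      apply Quot.sound
      refine ⟨x, y, ?_⟩
      rw [← hN]
      funext i j
      fin_cases i <;> fin_cases j <;> rfl

/-- The number of toroidal knot `(2,2)`-mosaics is `D_T^{(2,2)} = 110`. -/
theorem toroidal_two_two_count : DT 2 2 = 110 := by
  unfold DT
  rw [← Nat.card_congr (Equiv.ofBijective toQuot ⟨toQuot_inj, toQuot_surj⟩),
    Nat.card_eq_fintype_card, Fintype.card_subtype, Finset.card_filter]
  simp only [Fintype.sum_prod_type]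
  exact count_ok
end

section
/- For a prime integer p and every k with 0 ≤ k ≤ p−1, the number of p_{(k,1)}-f.period knot (p,p)-mosaics satisfies d_{p_{(k,1)}} = tr^{(k)}(X_p^+ + O_p^+) − 7. -/
open Finset

/-- Chain condition for a column `c` with left bits `a`, right bits `b`, top state `t`,
bottom state `u`. -/
def ColP (a b : ℕ → Bool) : (n : ℕ) → Bool → Bool → (Fin n → Fin 11) → Prop
  | 0, t, u, _ => t = u
  | n + 1, t, u, c => (cpL (c (Fin.last n)) = a n ∧ cpR (c (Fin.last n)) = b n ∧
      cpB (c (Fin.last n)) = u) ∧ ColP a b n t (cpT (c (Fin.last n))) (Fin.init c)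

open Classical in
/-- Number of such columns. -/
noncomputable def colG (a b : ℕ → Bool) (n : ℕ) (t u : Bool) : ℕ :=
  (univ.filter fun c : Fin n → Fin 11 => ColP a b n t u c).card

open Classical in
lemma colG_succ (a b : ℕ → Bool) (n : ℕ) (t u : Bool) :
    colG a b (n + 1) t u = ∑ x : Fin 11,
      if (cpL x = a n ∧ cpR x = b n ∧ cpB x = u) then colG a b n t (cpT x) else 0 := by
  unfold colG
  simp only [Finset.card_filter]
  rw [← (Fin.snocEquiv (fun _ : Fin (n+1) => Fin 11)).sum_comp, Fintype.sum_prod_type]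
  refine Finset.sum_congr rfl fun x _ => ?_
  by_cases h : cpL x = a n ∧ cpR x = b n ∧ cpB x = u
  · simp [ColP, h, Fin.snocEquiv]
  · rw [if_neg h]
    refine Finset.sum_eq_zero fun c _ => ?_
    simp [ColP, Fin.snocEquiv]
    intro h1 h2 h3
    exact absurd ⟨h1, h2, h3⟩ h

lemma colG_zero (a b : ℕ → Bool) (t u : Bool) :
    colG a b 0 t u = if t = u then 1 else 0 := by
  unfold colG
  by_cases h : t = u <;> simp [ColP, h]

lemma matsPM_mod (k i j : ℕ) : matsPM k (i % 2 ^ k) (j % 2 ^ k) = matsPM k i j := by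
  cases k with
  | zero => rfl
  | succ k =>
    have h1 : ∀ i : ℕ, (i % 2 ^ (k+1)) % 2 ^ k = i % 2 ^ k := fun i =>
      Nat.mod_mod_of_dvd _ (pow_dvd_pow 2 (Nat.le_succ k))
    have h2 : ∀ i : ℕ, (i % 2 ^ (k+1)) / 2 ^ k % 2 = i / 2 ^ k % 2 := fun i => by
      rw [pow_succ, Nat.mod_mul_right_div_self, Nat.mod_mod]
    simp only [matsPM, h1, h2]

lemma matsPM_eq (n i j : ℕ) : matsPM n i j =
    (colG i.testBit j.testBit n false false, colG i.testBit j.testBit n true false,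
      colG i.testBit j.testBit n true true, colG i.testBit j.testBit n false true) := by
  induction n with
  | zero => simp [matsPM, colG_zero]
  | succ n ih =>
    rw [matsPM, matsPM_mod, ih]
    simp only [colG_succ]
    have hb : ∀ i : ℕ, (i / 2 ^ n % 2 = 0) = (i.testBit n = false) := fun i => by
      rw [Nat.testBit_eq_decide_div_mod_eq]; simp
    simp only [hb]
    cases hi : i.testBit n <;> cases hj : j.testBit n <;>
      simp [Fin.sum_univ_succ, cpL, cpR, cpT, cpB] <;> (try constructor) <;> (try ring)

lemma colP_iff (a b : ℕ → Bool) (q : ℕ) (t u : Bool) (c : Fin (q+1) → Fin 11) :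
    ColP a b (q+1) t u c ↔ (∀ r, cpL (c r) = a r ∧ cpR (c r) = b r) ∧ cpT (c 0) = t ∧
      cpB (c (Fin.last q)) = u ∧ ∀ r : Fin q, cpB (c r.castSucc) = cpT (c r.succ) := by
  induction q generalizing t u with
  | zero =>
    simp [ColP]
    grind
  | succ q ih =>
    rw [ColP, ih]
    rw [Fin.forall_fin_succ' (n := q+1) (P := fun r => cpL (c r) = a r ∧ cpR (c r) = b r),
      Fin.forall_fin_succ' (n := q) (P := fun r => cpB (c r.castSucc) = cpT (c r.succ))]
    simp only [Fin.init, Fin.succ_last, Fin.succ_castSucc, Fin.val_last, Fin.val_castSucc,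
      Fin.castSucc_zero]
    tauto

lemma colG_cyc (q : ℕ) (i j : Fin (2 ^ (q+1))) :
    (Xplus (q+1) + Oplus (q+1)) i j = Nat.card {c : Fin (q+1) → Fin 11 //
      (∀ r, cpL (c r) = (i:ℕ).testBit r ∧ cpR (c r) = (j:ℕ).testBit r) ∧
      ∀ r, cpB (c r) = cpT (c (r + 1))} := by
  classical
  have : (Xplus (q+1) + Oplus (q+1)) i j =
    colG (i:ℕ).testBit (j:ℕ).testBit (q+1) false false +
    colG (i:ℕ).testBit (j:ℕ).testBit (q+1) true true := by
    simp [Xplus, Oplus, matsPM_eq]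
  rw [this, colG, colG, ← Finset.card_union_of_disjoint, ← Finset.filter_or, Nat.card_eq_fintype_card,
    Fintype.card_subtype]
  · congr 1
    ext c
    simp only [mem_filter, mem_univ, true_and, colP_iff]
    rw [Fin.forall_fin_succ' (n := q) (P := fun r => cpB (c r) = cpT (c (r+1)))]
    simp only [Fin.last_add_one, Fin.coeSucc_eq_succ]
    cases cpT (c 0) <;> simp <;> tauto
  · rw [Finset.disjoint_filter]
    intro c _ h1 h2
    rw [colP_iff] at h1 h2
    simp [h1.2.1] at h2

lemma alpha_step (q i : ℕ) (hi : i < 2 ^ (q+1) - 1) (r : Fin (q+1)) :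
    (2 * i % (2 ^ (q+1) - 1)).testBit r = i.testBit ((r - 1 : Fin (q+1)) : ℕ) := by
  have hp : 2 ^ (q+1) = 2 * 2 ^ q := by ring
  have hpos : 0 < 2 ^ q := Nat.two_pow_pos q
  have key : 2 * i % (2 ^ (q+1) - 1) = 2 * (i % 2 ^ q) + (i.testBit q).toNat := by
    by_cases h : i < 2 ^ q
    · rw [Nat.testBit_lt_two_pow h, Nat.mod_eq_of_lt h, Nat.mod_eq_of_lt]
      · rfl
      · omega
    · have h1 : i.testBit q = true := by
        rw [Nat.testBit_eq_decide_div_mod_eq]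
        have : i / 2 ^ q = 1 := by
          rw [Nat.div_eq_iff hpos]; omega
        simp [this]
      have h2 : i % 2 ^ q = i - 2 ^ q := by
        rw [Nat.mod_eq_sub_mod (by omega), Nat.mod_eq_of_lt (by omega)]
      rw [h1, h2, Nat.mod_eq_sub_mod (by omega), Nat.mod_eq_of_lt (by omega)]
      simp; omega
  rw [key]
  refine Fin.cases ?_ (fun s => ?_) r
  · have : ((0 - 1 : Fin (q+1)) : ℕ) = q := by simp
    rw [this]
    cases i.testBit q <;> simp
  · have : ((s.succ - 1 : Fin (q+1)) : ℕ) = s := by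
      rw [← Fin.coeSucc_eq_succ, add_sub_cancel_right]; simp
    rw [this, Fin.val_succ, Nat.testBit_succ]
    have : (2 * (i % 2 ^ q) + (i.testBit q).toNat) / 2 = i % 2 ^ q := by
      cases i.testBit q <;> simp <;> omega
    rw [this, Nat.testBit_mod_two_pow]
    simp

open Fin.CommRing in
lemma alpha_bits (q k : ℕ) (i : Fin (2 ^ (q+1))) (r : Fin (q+1)) :
    (alphaIdx (q+1) k i : ℕ).testBit r = (i : ℕ).testBit ((r - (k : Fin (q+1)) : Fin (q+1)) : ℕ) := by
  unfold alphaIdx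
  split_ifs with h
  · rw [h]; simp [Nat.testBit_two_pow_sub_one]; omega
  · simp only
    have hi : (i:ℕ) < 2 ^ (q+1) - 1 := by have := i.isLt; omega
    induction k generalizing r with
    | zero => simp [Nat.mod_eq_of_lt hi]
    | succ k ih =>
      have : 2 ^ (k+1) * (i:ℕ) % (2 ^ (q+1) - 1) =
          2 * (2 ^ k * (i:ℕ) % (2 ^ (q+1) - 1)) % (2 ^ (q+1) - 1) := by
        rw [Nat.mul_mod 2 (_ % _), Nat.mod_mod, ← Nat.mul_mod]; congr 1; ring
      rw [this, alpha_step _ _ (Nat.mod_lt _ (by omega)), ih]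
      congr 2
      push_cast
      ring

/-- Columns generating the invariant mosaics. -/
abbrev GenCol (q : ℕ) (k : Fin (q+1)) :=
  {c : Fin (q+1) → Fin 11 // (∀ r, cpR (c r) = cpL (c (r - k))) ∧
    ∀ r, cpB (c r) = cpT (c (r + 1))}

open Fin.CommRing in
lemma trk_eq (q k : ℕ) : trk (q+1) k (Xplus (q+1) + Oplus (q+1)) =
    Nat.card (GenCol q (k : Fin (q+1))) := by
  classical
  unfold trk
  rw [Nat.card_eq_fintype_card, Fintype.card_subtype]
  let f : (Fin (q+1) → Fin 11) → Fin (2 ^ (q+1)) := fun c =>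
    ⟨Nat.ofBits (fun r => cpL (c r)), Nat.ofBits_lt_two_pow _⟩
  have hf : ∀ c a, f c = a ↔ ∀ r : Fin (q+1), cpL (c r) = (a:ℕ).testBit r := by
    intro c a
    constructor
    · rintro rfl r
      simp only [f]
      rw [Nat.testBit_ofBits_lt _ _ r.isLt]
    · intro h
      apply Fin.ext
      apply Nat.eq_of_testBit_eq
      intro r
      by_cases hr : r < q + 1
      · simp [f, Nat.testBit_ofBits_lt, hr, h]
      · rw [Nat.testBit_lt_two_pow (lt_of_lt_of_le (Fin.isLt _) (Nat.pow_le_pow_right (by norm_num) (by omega))),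
          Nat.testBit_lt_two_pow (lt_of_lt_of_le (Fin.isLt _) (Nat.pow_le_pow_right (by norm_num) (by omega)))]
  rw [Finset.card_eq_sum_card_fiberwise (f := f) (t := univ) (fun _ _ => by simp)]
  refine Finset.sum_congr rfl fun a _ => ?_
  rw [colG_cyc, Nat.card_eq_fintype_card, Fintype.card_subtype, Finset.filter_filter]
  congr 1
  ext c
  simp only [mem_filter, mem_univ, true_and, hf, alpha_bits]
  constructor
  · rintro ⟨h1, h2⟩
    exact ⟨⟨fun r => by rw [(h1 r).2, (h1 _).1], h2⟩, fun r => (h1 r).1⟩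
  · rintro ⟨⟨h1, h2⟩, h3⟩
    exact ⟨fun r => ⟨h3 r, by rw [h1, h3]⟩, h2⟩

lemma periodKnot_iff (q : ℕ) (M : Mosaic (q+1) (q+1)) : PeriodKnot M ↔
    (∀ i j, cpR (M i j) = cpL (M i (j+1))) ∧ ∀ i j, cpB (M i j) = cpT (M (i+1) j) := by
  have h1 : ∀ (j : Fin (q+1)) (h : j.val + 1 < q + 1), (⟨j.val+1, h⟩ : Fin (q+1)) = j + 1 := by
    intro j h
    apply Fin.ext
    rw [Fin.val_add_one_of_lt' h]
  have h2 : ∀ j j' : Fin (q+1), j.val = 0 → j'.val = q + 1 - 1 → j = j' + 1 := by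
    intro j j' h h'
    have : j' = Fin.last q := Fin.ext (by simpa using h')
    rw [this, Fin.last_add_one]; exact Fin.ext h
  have h3 : ∀ j : Fin (q+1), (j.val + 1 < q + 1) ∨ ((j+1 : Fin (q+1)).val = 0 ∧ j.val = q + 1 - 1) := by
    intro j
    rcases Nat.lt_or_ge (j.val + 1) (q+1) with h | h
    · exact Or.inl h
    · right
      have : j = Fin.last q := Fin.ext (by simp; omega)
      subst this; simp
  constructor
  · rintro ⟨⟨a, b⟩, c, d⟩
    constructor
    · intro i j
      rcases h3 j with h | h
      · rw [a i j h, h1]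
      · exact (c i _ _ h.1 h.2).symm
    · intro i j
      rcases h3 i with h | h
      · rw [b i h j, h1]
      · exact (d _ _ j h.1 h.2).symm
  · rintro ⟨a, b⟩
    refine ⟨⟨fun i j h => ?_, fun i h j => ?_⟩, fun i j j' h h' => ?_, fun i i' j h h' => ?_⟩
    · rw [h1, a]
    · rw [h1, b]
    · rw [h2 j j' h h', a]
    · rw [h2 i i' h h', b]

open Fin.CommRing in
lemma shiftIdx_eq (q k : ℕ) (i : Fin (q+1)) : shiftIdx (k:ℤ) i = i - (k : Fin (q+1)) := by
  rw [eq_sub_iff_add_eq]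
  apply Fin.ext
  rw [Fin.val_add, Fin.val_natCast, Nat.add_mod_mod]
  have h0 : ((shiftIdx (k:ℤ) i : Fin (q+1)) : ℤ) = ((i:ℤ) - k) % ((q+1 : ℕ):ℤ) := by
    simp only [shiftIdx]
    exact Int.toNat_of_nonneg (Int.emod_nonneg _ (by omega))
  zify
  rw [h0]
  have := Int.emod_add_emod ((i:ℤ) - k) ((q+1 : ℕ):ℤ) k
  push_cast at this ⊢
  rw [this, sub_add_cancel]
  exact Int.emod_eq_of_lt (by omega) (by have := i.isLt; omega)

open Fin.CommRing in
lemma tshift_iff (q k l : ℕ) (M : Mosaic (q+1) (q+1)) : M = tshift (k:ℤ) (l:ℤ) M ↔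
    ∀ i j, M i j = M (i - (k : Fin (q+1))) (j - (l : Fin (q+1))) := by
  constructor
  · intro h i j
    conv_lhs => rw [h]
    simp only [tshift, shiftIdx_eq]
  · intro h
    funext i j
    simp only [tshift, shiftIdx_eq]
    exact h i j

open Fin.CommRing in
lemma const_iff (q : ℕ) (M : Mosaic (q+1) (q+1)) :
    IsFPeriod 1 1 M ↔ ∀ i j, M i j = M 0 0 := by
  have e1 := tshift_iff q 1 0 M
  have e2 := tshift_iff q 0 1 M
  have hI : IsFPeriod 1 1 M ↔ M = tshift 1 0 M ∧ M = tshift 0 1 M := by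
    simp only [IsFPeriod, IsLeast, lowerBounds, Set.mem_ofPred_eq]
    constructor
    · rintro ⟨⟨a, _⟩, ⟨b, _⟩⟩
      exact ⟨by simpa using a.2, by simpa using b.2⟩
    · rintro ⟨a, b⟩
      exact ⟨⟨⟨one_pos, by simpa using a⟩, fun _ h => h.1⟩, ⟨⟨one_pos, by simpa using b⟩, fun _ h => h.1⟩⟩
  push_cast at e1 e2
  rw [hI, e1, e2]
  simp only [sub_zero]
  constructor
  · rintro ⟨a, b⟩ i j
    have ha : ∀ (n : ℕ) j, M (n : Fin (q+1)) j = M 0 j := by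
      intro n j
      induction n with
      | zero => simp
      | succ n ih => rw [a, ← ih]; push_cast; rw [add_sub_cancel_right]
    have hb : ∀ (n : ℕ) i, M i (n : Fin (q+1)) = M i 0 := by
      intro n i
      induction n with
      | zero => simp
      | succ n ih => rw [b, ← ih]; push_cast; rw [add_sub_cancel_right]
    have := ha i j
    have h' := hb j 0
    rw [Fin.cast_val_eq_self] at this h'
    rw [this, h']
  · intro h
    exact ⟨fun i j => by rw [h, h (i-1)], fun i j => by rw [h, h i (j-1)]⟩

open Fin.CommRing in
lemma inv_eq (q : ℕ) (k : Fin (q+1)) (M : Mosaic (q+1) (q+1))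
    (h : ∀ i j, M i j = M (i - k) (j - 1)) (i j : Fin (q+1)) : M i j = M (i - j * k) 0 := by
  have : ∀ (n : ℕ) i, M i (n : Fin (q+1)) = M (i - n * k) 0 := by
    intro n
    induction n with
    | zero => simp
    | succ n ih =>
      intro i
      rw [h]; push_cast; rw [add_sub_cancel_right, ih]; congr 1; ring
  have := this j i
  rwa [Fin.cast_val_eq_self] at this

open Fin.CommRing in
/-- Invariant mosaics correspond to generating columns. -/
def genEquiv (q k : ℕ) : {M : Mosaic (q+1) (q+1) // PeriodKnot M ∧ M = tshift (k:ℤ) 1 M} ≃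
    GenCol q (k : Fin (q+1)) where
  toFun M := ⟨fun i => M.1 i 0, by
    obtain ⟨M, h1, h2⟩ := M
    rw [periodKnot_iff] at h1
    have h3 := (tshift_iff q k 1 M).1 (by simpa using h2)
    refine ⟨fun r => ?_, fun r => h1.2 r 0⟩
    simp only [h1.1]
    rw [h3 r]
    simp⟩
  invFun c := ⟨fun i j => c.1 (i - j * (k : Fin (q+1))), by
    obtain ⟨c, h1, h2⟩ := c
    constructor
    · rw [periodKnot_iff]
      refine ⟨fun i j => ?_, fun i j => ?_⟩
      · simp only [h1]; congr 2; ring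
      · simp only [h2]; congr 2; ring
    · have := (tshift_iff q k 1 (fun i j => c (i - j * (k : Fin (q+1))))).2 (fun i j => by
        push_cast; congr 1; ring)
      simpa using this⟩
  left_inv M := by
    obtain ⟨M, h1, h2⟩ := M
    have h3 := (tshift_iff q k 1 M).1 (by simpa using h2)
    push_cast at h3
    apply Subtype.ext
    funext i j
    exact (inv_eq q _ M h3 i j).symm
  right_inv c := by
    apply Subtype.ext
    funext i
    simp

open Fin.CommRing in
/-- Constant period knot mosaics. -/
def constEquiv (q : ℕ) (k : ℕ) : {M : Mosaic (q+1) (q+1) // (PeriodKnot M ∧ M = tshift (k:ℤ) 1 M) ∧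
    IsFPeriod 1 1 M} ≃ {x : Fin 11 // cpR x = cpL x ∧ cpB x = cpT x} where
  toFun M := ⟨M.1 0 0, by
    obtain ⟨M, ⟨h1, _⟩, h2⟩ := M
    rw [const_iff] at h2
    rw [periodKnot_iff] at h1
    have a := h1.1 0 0
    have b := h1.2 0 0
    rw [h2 0 (0+1)] at a
    rw [h2 (0+1) 0] at b
    exact ⟨a, b⟩⟩
  invFun x := ⟨fun _ _ => x.1, ⟨(periodKnot_iff _ _).2 ⟨fun _ _ => x.2.1, fun _ _ => x.2.2⟩, rfl⟩,
    (const_iff _ _).2 fun _ _ => rfl⟩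
  left_inv M := by
    obtain ⟨M, ⟨h1, _⟩, h2⟩ := M
    rw [const_iff] at h2
    apply Subtype.ext
    funext i j
    exact (h2 i j).symm
  right_inv x := rfl

/-- For a prime `p` and `0 ≤ k ≤ p-1`,
`d_{p_{(k,1)}} = tr^{(k)}(X_p^+ + O_p^+) − 7`. -/
theorem pk1_fperiod_count (p : ℕ) (hP : p.Prime) (k : ℕ) (hk : k ≤ p - 1) :
    dPk p k + 7 = trk p k (Xplus p + Oplus p) := by
  classical
  obtain ⟨q, rfl⟩ : ∃ q, p = q + 1 := ⟨p - 1, by have := hP.pos; omega⟩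
  rw [trk_eq, ← Nat.card_congr (genEquiv q k)]
  have h7 : Nat.card {x : Fin 11 // cpR x = cpL x ∧ cpB x = cpT x} = 7 := by
    rw [Nat.card_eq_fintype_card]; decide
  rw [← h7, ← Nat.card_congr (constEquiv q k), dPk]
  simp only [Nat.card_eq_fintype_card, Fintype.card_subtype]
  rw [← Finset.card_filter_add_card_filter_not (s := univ.filter fun M : Mosaic (q+1) (q+1) =>
    PeriodKnot M ∧ M = tshift (k:ℤ) 1 M) (IsFPeriod 1 1), add_comm]
  simp only [Finset.filter_filter]
  congr 2
  ext M
  rw [mem_filter, mem_filter]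
  unfold IsPk1FPeriod
  tauto
end
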